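/- Let q ∈ ℂ with 0 < |q| < 1. With m(x,q,z) := (1/j(z;q)) · Σ_{r ∈ ℤ} (-1)^r q^{r(r-1)/2} z^r / (1 - q^{r-1} x z) for generic x, z ∈ ℂ*, one has m(x,q,z) = x⁻¹ - x⁻¹ · m(qx, q, z). -/

import Mathlib

noncomputable def qPoch (x q : ℂ) : ℂ := ∏' k : ℕ, (1 - x * q ^ k)

noncomputable def jP (z q : ℂ) : ℂ := qPoch z q * qPoch (q / z) q * qPoch q q

noncomputable def mAL (x q z : ℂ) : ℂ :=
  (1 / jP z q) * ∑' r : ℤ, ((-1 : ℂ) ^ r * q ^ (r * (r - 1) / 2) * z ^ r) /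
    (1 - q ^ (r - 1) * x * z)

open Filter Topology Finset

/-- The general term of the bilateral theta series. -/
noncomputable def thetaTerm (q z : ℂ) (r : ℤ) : ℂ :=
  (-1 : ℂ) ^ r * q ^ (r * (r - 1) / 2) * z ^ r

lemma thetaTerm_succ {q z : ℂ} (hq0 : q ≠ 0) (hz : z ≠ 0) (r : ℤ) :
    thetaTerm q z (r + 1) = -(q ^ r * z) * thetaTerm q z r := by
  have h : (r + 1) * (r + 1 - 1) / 2 = r * (r - 1) / 2 + r := by
    rw [← Int.add_mul_ediv_right _ _ two_ne_zero]
    ring_nf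
  rw [thetaTerm, thetaTerm, h, zpow_add₀ hq0, zpow_add_one₀ hz, zpow_add_one₀ (by norm_num)]
  ring

lemma thetaTerm_ne_zero {q z : ℂ} (hq0 : q ≠ 0) (hz : z ≠ 0) (r : ℤ) :
    thetaTerm q z r ≠ 0 :=
  mul_ne_zero (mul_ne_zero (zpow_ne_zero _ (by norm_num)) (zpow_ne_zero _ hq0))
    (zpow_ne_zero _ hz)

lemma summable_norm_of_ratio_tendsto_zero {f : ℕ → ℂ} (hf : ∀ n, f n ≠ 0)
    (h : Tendsto (fun n ↦ f (n + 1) / f n) atTop (𝓝 0)) : Summable fun n ↦ ‖f n‖ := by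
  refine summable_of_ratio_test_tendsto_lt_one (l := 0) zero_lt_one
    (Eventually.of_forall fun n ↦ norm_ne_zero_iff.2 (hf n)) ?_
  simpa using h.norm

lemma summable_norm_thetaTerm {q z : ℂ} (hq0 : q ≠ 0) (hq : ‖q‖ < 1) (hz : z ≠ 0) :
    Summable fun r ↦ ‖thetaTerm q z r‖ := by
  have hpow := tendsto_pow_atTop_nhds_zero_of_norm_lt_one hq
  refine Summable.of_nat_of_neg ?_ ?_
  · refine summable_norm_of_ratio_tendsto_zero (f := fun n : ℕ ↦ thetaTerm q z n)
      (fun n ↦ thetaTerm_ne_zero hq0 hz _) ?_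
    have h : ∀ n : ℕ, thetaTerm q z ((n + 1 : ℕ) : ℤ) / thetaTerm q z n = -(q ^ n * z) := by
      intro n
      rw [Nat.cast_succ, thetaTerm_succ hq0 hz, mul_div_assoc,
        div_self (thetaTerm_ne_zero hq0 hz _), mul_one, zpow_natCast]
    simp only [h]
    simpa using (hpow.mul_const z).neg
  · refine summable_norm_of_ratio_tendsto_zero (f := fun n : ℕ ↦ thetaTerm q z (-n))
      (fun n ↦ thetaTerm_ne_zero hq0 hz _) ?_
    have h : ∀ n : ℕ,
        thetaTerm q z (-((n + 1 : ℕ) : ℤ)) / thetaTerm q z (-n) = -(q ^ n * (q / z)) := by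
      intro n
      have h1 := thetaTerm_succ hq0 hz (-((n + 1 : ℕ) : ℤ))
      rw [show -((n + 1 : ℕ) : ℤ) + 1 = -n by push_cast; ring] at h1
      have h2 := thetaTerm_ne_zero hq0 hz (-((n + 1 : ℕ) : ℤ))
      rw [h1, zpow_neg, zpow_natCast]
      field_simp
      rw [pow_succ]
    simp only [h]
    simpa using (hpow.mul_const (q / z)).neg

/-- The reciprocal of the finite `q`-Pochhammer symbol `(q; q)_m`, extended by zero to
negative `m`. -/
noncomputable def qFactInv (q : ℂ) (m : ℤ) : ℂ :=
  if 0 ≤ m then (∏ k ∈ range m.toNat, (1 - q * q ^ k))⁻¹ else 0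

lemma one_sub_mul_pow_ne_zero {q : ℂ} (hq : ‖q‖ < 1) (k : ℕ) : 1 - q * q ^ k ≠ 0 := by
  intro h
  have h1 : ‖q ^ (k + 1)‖ < 1 := by
    rw [norm_pow]
    exact pow_lt_one₀ (norm_nonneg _) hq k.succ_ne_zero
  rw [pow_succ', ← sub_eq_zero.1 h, norm_one] at h1
  exact lt_irrefl _ h1

lemma qFactInv_sub_one {q : ℂ} (hq : ‖q‖ < 1) (m : ℤ) :
    qFactInv q (m - 1) = (1 - q ^ m) * qFactInv q m := by
  rcases lt_trichotomy m 0 with h | rfl | h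
  · rw [qFactInv, qFactInv, if_neg (by lia), if_neg (by lia), mul_zero]
  · simp [qFactInv]
  · obtain ⟨n, rfl⟩ : ∃ n : ℕ, m = n + 1 := ⟨(m - 1).toNat, by lia⟩
    have h1 := one_sub_mul_pow_ne_zero hq n
    rw [add_sub_cancel_right, qFactInv, qFactInv, if_pos (by lia), if_pos (by lia),
      Int.toNat_natCast, Int.toNat_natCast_add_one, prod_range_succ, mul_inv,
      show q ^ ((n : ℤ) + 1) = q * q ^ n by rw [← pow_succ']; norm_cast]
    field_simp

/-- The finite form of the Jacobi triple product identity. -/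
lemma hasSum_thetaTerm_mul_qBinomial {q z : ℂ} (hq0 : q ≠ 0) (hq : ‖q‖ < 1) (hz : z ≠ 0)
    (n : ℕ) :
    HasSum (fun r : ℤ ↦ thetaTerm q z r *
        ((∏ k ∈ range (2 * n), (1 - q * q ^ k)) * qFactInv q (n - r) * qFactInv q (n + r)))
      ((∏ k ∈ range n, (1 - z * q ^ k)) * ∏ k ∈ range n, (1 - q / z * q ^ k)) := by
  induction n with
  | zero =>
    convert hasSum_ite_eq (0 : ℤ) (1 : ℂ) using 2 with r
    rcases lt_trichotomy r 0 with h | rfl | h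
    · simp [qFactInv, show ¬ 0 ≤ r by lia, h.ne]
    · simp [qFactInv, thetaTerm]
    · simp [qFactInv, show ¬ r ≤ 0 by lia, h.ne']
    · simp
  | succ n ih =>
    have hup := ((Equiv.subRight (1 : ℤ)).hasSum_iff.2 ih).mul_left (-(z * q ^ n))
    have hdown := ((Equiv.addRight (1 : ℤ)).hasSum_iff.2 ih).mul_left (-(q / z * q ^ n))
    have hadd := ((ih.mul_left (1 + q ^ (2 * n + 1))).add hup).add hdown
    have hprod : (1 + q ^ (2 * n + 1)) * ((∏ k ∈ range n, (1 - z * q ^ k)) *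
        ∏ k ∈ range n, (1 - q / z * q ^ k)) + -(z * q ^ n) * ((∏ k ∈ range n, (1 - z * q ^ k)) *
        ∏ k ∈ range n, (1 - q / z * q ^ k)) + -(q / z * q ^ n) *
        ((∏ k ∈ range n, (1 - z * q ^ k)) * ∏ k ∈ range n, (1 - q / z * q ^ k)) =
        (∏ k ∈ range (n + 1), (1 - z * q ^ k)) * ∏ k ∈ range (n + 1), (1 - q / z * q ^ k) := by
      rw [prod_range_succ, prod_range_succ]
      field_simp
      ring
    rw [hprod] at hadd
    refine hadd.congr_fun fun r ↦ ?_
    simp only [Function.comp_apply, Equiv.subRight_apply, Equiv.coe_addRight]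
    have ht := thetaTerm_succ hq0 hz (r - 1)
    rw [sub_add_cancel] at ht
    have e1 := qFactInv_sub_one hq (n + 1 - r)
    have e2 := qFactInv_sub_one hq (n + 1 + r)
    have e3 := qFactInv_sub_one hq (n - r)
    have e4 := qFactInv_sub_one hq (n + r)
    rw [show (n : ℤ) + 1 - r - 1 = n - r by ring] at e1
    rw [show (n : ℤ) + 1 + r - 1 = n + r by ring] at e2
    rw [e1] at e3
    rw [e2] at e4
    rw [show (n : ℤ) - (r - 1) = n + 1 - r by ring, show (n : ℤ) + (r - 1) = n + r - 1 by ring,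
      show (n : ℤ) - (r + 1) = n - r - 1 by ring, show (n : ℤ) + (r + 1) = n + 1 + r by ring,
      e4, e3, e1, e2, thetaTerm_succ hq0 hz r, ht,
      show 2 * (n + 1) = 2 * n + 1 + 1 by ring, prod_range_succ, prod_range_succ]
    push_cast
    have hr : q ^ r ≠ 0 := zpow_ne_zero _ hq0
    simp only [zpow_add₀ hq0, zpow_sub₀ hq0, zpow_one, zpow_natCast]
    field_simp
    ring

lemma multipliable_one_sub_mul_pow {q : ℂ} (hq : ‖q‖ < 1) (x : ℂ) :
    Multipliable fun k : ℕ ↦ 1 - x * q ^ k := by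
  simp only [sub_eq_add_neg]
  refine multipliable_one_add_of_summable ?_
  simpa using! (summable_geometric_of_lt_one (norm_nonneg _) hq).mul_left ‖x‖

lemma tendsto_prod_qPoch {q : ℂ} (hq : ‖q‖ < 1) (x : ℂ) :
    Tendsto (fun n ↦ ∏ k ∈ range n, (1 - x * q ^ k)) atTop (𝓝 (qPoch x q)) :=
  (multipliable_one_sub_mul_pow hq x).tendsto_prod_tprod_nat

lemma qPoch_ne_zero {q x : ℂ} (hq : ‖q‖ < 1) (h : ∀ k : ℕ, 1 - x * q ^ k ≠ 0) :
    qPoch x q ≠ 0 := by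
  simp only [qPoch, sub_eq_add_neg] at h ⊢
  refine tprod_one_add_ne_zero_of_summable h ?_
  simpa using! (summable_geometric_of_lt_one (norm_nonneg _) hq).mul_left ‖x‖

/-- The Jacobi triple product identity. -/
theorem tsum_thetaTerm {q z : ℂ} (hq0 : q ≠ 0) (hq : ‖q‖ < 1) (hz : z ≠ 0) :
    ∑' r, thetaTerm q z r = jP z q := by
  have hQ : qPoch q q ≠ 0 := qPoch_ne_zero hq (one_sub_mul_pow_ne_zero hq)
  have hQt := tendsto_prod_qPoch hq q
  obtain ⟨C, hC⟩ := hQt.norm.bddAbove_range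
  obtain ⟨D, hD⟩ := (hQt.inv₀ hQ).norm.bddAbove_range
  have hC' : ∀ n, ‖∏ k ∈ range n, (1 - q * q ^ k)‖ ≤ C := fun n ↦ hC ⟨n, rfl⟩
  have hD0 : 0 ≤ D := (norm_nonneg _).trans (hD ⟨0, rfl⟩)
  have hC0 : 0 ≤ C := (norm_nonneg _).trans (hC ⟨0, rfl⟩)
  have hD' : ∀ m, ‖qFactInv q m‖ ≤ D := by
    intro m
    rw [qFactInv]
    split_ifs
    · exact hD ⟨m.toNat, rfl⟩
    · simpa using hD0
  have hlim : ∀ g : ℕ → ℤ, Tendsto g atTop atTop →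
      Tendsto (fun n ↦ qFactInv q (g n)) atTop (𝓝 (qPoch q q)⁻¹) := by
    intro g hg
    have hg' : Tendsto (fun n ↦ (g n).toNat) atTop atTop :=
      tendsto_atTop.2 fun b ↦ (hg.eventually_ge_atTop (b : ℤ)).mono fun n hn ↦ by lia
    refine ((hQt.comp hg').inv₀ hQ).congr' ?_
    filter_upwards [hg.eventually_ge_atTop 0] with n hn
    simp [qFactInv, hn]
  have hsum := tendsto_tsum_of_dominated_convergence (𝓕 := atTop)
    (f := fun (n : ℕ) (r : ℤ) ↦ thetaTerm q z r *
      ((∏ k ∈ range (2 * n), (1 - q * q ^ k)) * qFactInv q (n - r) * qFactInv q (n + r)))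
    (g := fun r ↦ thetaTerm q z r * (qPoch q q * (qPoch q q)⁻¹ * (qPoch q q)⁻¹))
    ((summable_norm_thetaTerm hq0 hq hz).mul_right (C * D * D))
    (fun r ↦ by
      have h2 : Tendsto (fun n : ℕ ↦ 2 * n) atTop atTop :=
        tendsto_id.const_mul_atTop' two_pos
      exact tendsto_const_nhds.mul (((hQt.comp h2).mul
        (hlim _ (tendsto_atTop_add_const_right _ (-r) tendsto_natCast_atTop_atTop))).mul
        (hlim _ (tendsto_atTop_add_const_right _ r tendsto_natCast_atTop_atTop))))
    (Eventually.of_forall fun n r ↦ by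
      simp only [norm_mul]
      gcongr
      exacts [hC' _, hD' _, hD' _])
  simp only [(hasSum_thetaTerm_mul_qBinomial hq0 hq hz _).tsum_eq] at hsum
  have h := tendsto_nhds_unique hsum
    ((tendsto_prod_qPoch hq z).mul (tendsto_prod_qPoch hq (q / z)))
  rw [tsum_mul_right, mul_inv_cancel₀ hQ, one_mul] at h
  rw [jP, ← h, inv_mul_cancel_right₀ hQ]

lemma jP_ne_zero {q z : ℂ} (hq0 : q ≠ 0) (hq : ‖q‖ < 1) (hz : z ≠ 0)
    (hz' : ∀ k : ℤ, z ≠ q ^ k) : jP z q ≠ 0 := by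
  refine mul_ne_zero (mul_ne_zero (qPoch_ne_zero hq fun k h ↦ ?_)
    (qPoch_ne_zero hq fun k h ↦ ?_)) (qPoch_ne_zero hq (one_sub_mul_pow_ne_zero hq))
  · refine hz' (-k) ?_
    rw [zpow_neg, zpow_natCast]
    exact eq_inv_of_mul_eq_one_left (sub_eq_zero.1 h).symm
  · refine hz' (k + 1) ?_
    rw [zpow_add_one₀ hq0, zpow_natCast]
    field_simp at h
    linear_combination h

lemma exists_norm_inv_one_sub_zpow_mul_le {q y : ℂ} (hq0 : q ≠ 0) (hq : ‖q‖ < 1) (hy : y ≠ 0)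
    (hy' : ∀ k : ℤ, y ≠ q ^ k) : ∃ C, ∀ r : ℤ, ‖(1 - q ^ r * y)⁻¹‖ ≤ C := by
  have hpow := tendsto_pow_atTop_nhds_zero_of_norm_lt_one hq
  have h1 : Tendsto (fun n : ℕ ↦ (1 - q ^ n * y)⁻¹) atTop (𝓝 1) := by
    simpa using ((hpow.mul_const y).const_sub 1).inv₀ (by simp)
  have h2 : Tendsto (fun n : ℕ ↦ q ^ n * (q ^ n - y)⁻¹) atTop (𝓝 0) := by
    simpa using hpow.mul ((hpow.sub_const y).inv₀ (by simpa using hy))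
  obtain ⟨C, hC⟩ := h1.norm.bddAbove_range
  obtain ⟨D, hD⟩ := h2.norm.bddAbove_range
  refine ⟨max C D, fun r ↦ ?_⟩
  obtain ⟨n, rfl | rfl⟩ := r.eq_nat_or_neg
  · rw [zpow_natCast]
    exact (hC ⟨n, rfl⟩).trans (le_max_left _ _)
  · refine le_trans (le_of_eq ?_) ((hD ⟨n, rfl⟩).trans (le_max_right _ _))
    have hn : q ^ n - y ≠ 0 := sub_ne_zero.2 fun h ↦ hy' n (by rw [← h, zpow_natCast])
    rw [zpow_neg, zpow_natCast, show 1 - (q ^ n)⁻¹ * y = (q ^ n)⁻¹ * (q ^ n - y) by field_simp,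
      mul_inv, inv_inv]

lemma summable_thetaTerm_div {q z y : ℂ} (hq0 : q ≠ 0) (hq : ‖q‖ < 1) (hz : z ≠ 0)
    (hy : y ≠ 0) (hy' : ∀ k : ℤ, y ≠ q ^ k) :
    Summable fun r : ℤ ↦ thetaTerm q z r / (1 - q ^ r * y) := by
  obtain ⟨C, hC⟩ := exists_norm_inv_one_sub_zpow_mul_le hq0 hq hy hy'
  refine Summable.of_norm_bounded ((summable_norm_thetaTerm hq0 hq hz).mul_right C) fun r ↦ ?_
  rw [div_eq_mul_inv, norm_mul]
  gcongr
  exact hC r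

theorem mAL_shift (q x z : ℂ) (hq0 : q ≠ 0) (hq : ‖q‖ < 1)
    (hx : x ≠ 0) (hz : z ≠ 0)
    (hz' : ∀ k : ℤ, z ≠ q ^ k) (hxz : ∀ k : ℤ, x * z ≠ q ^ k) :
    mAL x q z = x⁻¹ - x⁻¹ * mAL (q * x) q z := by
  have hj := jP_ne_zero hq0 hq hz hz'
  have hS := summable_thetaTerm_div hq0 hq hz (mul_ne_zero hx hz) hxz
  have hT := summable_norm_thetaTerm hq0 hq hz |>.of_norm
  have hden : ∀ r : ℤ, 1 - q ^ r * (x * z) ≠ 0 := fun r h ↦ hxz (-r) <| by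
    rw [zpow_neg]
    exact eq_inv_of_mul_eq_one_right (sub_eq_zero.1 h).symm
  have h1 : ∑' r : ℤ, ((-1 : ℂ) ^ r * q ^ (r * (r - 1) / 2) * z ^ r) /
      (1 - q ^ (r - 1) * x * z) =
      x⁻¹ * (jP z q - ∑' r : ℤ, thetaTerm q z r / (1 - q ^ r * (x * z))) := by
    rw [← tsum_thetaTerm hq0 hq hz, ← hT.tsum_sub hS, ← tsum_mul_left,
      ← (Equiv.addRight (1 : ℤ)).tsum_eq]
    refine tsum_congr fun r ↦ ?_
    have hd := hden r
    change thetaTerm q z (r + 1) / (1 - q ^ (r + 1 - 1) * x * z) = _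
    rw [thetaTerm_succ hq0 hz, add_sub_cancel_right, mul_assoc (q ^ r) x z]
    rw [eq_inv_mul_iff_mul_eq₀ hx, ← mul_div_assoc, eq_sub_iff_add_eq, ← add_div, div_eq_iff hd]
    ring
  have h2 : ∑' r : ℤ, ((-1 : ℂ) ^ r * q ^ (r * (r - 1) / 2) * z ^ r) /
      (1 - q ^ (r - 1) * (q * x) * z) = ∑' r : ℤ, thetaTerm q z r / (1 - q ^ r * (x * z)) := by
    refine tsum_congr fun r ↦ ?_
    rw [thetaTerm, ← mul_assoc (q ^ (r - 1)), ← zpow_add_one₀ hq0, sub_add_cancel, mul_assoc (q ^ r)]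
  rw [mAL, mAL, h1, h2]
  generalize ∑' r : ℤ, thetaTerm q z r / (1 - q ^ r * (x * z)) = S
  field_simp
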